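/- The Baumslag-Solitar group BS(l,k) = ⟨x, t ∣ t⁻¹ xˡ t = xᵏ⟩ with l, k nonzero is residually solvable. -/

import Mathlib

namespace Stmt9

/-- The relator `t⁻¹ xˡ t x⁻ᵏ` of `BS(l,k)` (generator `0` is `x`, generator `1` is `t`). -/
def rel (l k : ℤ) : FreeGroup (Fin 2) :=
  (FreeGroup.of 1)⁻¹ * (FreeGroup.of 0) ^ l * FreeGroup.of 1 * (FreeGroup.of 0) ^ (-k)

/-- The Baumslag–Solitar group `BS(l,k) = ⟨x, t ∣ t⁻¹ xˡ t = xᵏ⟩`. -/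
abbrev BS (l k : ℤ) := PresentedGroup ({rel l k} : Set (FreeGroup (Fin 2)))

open scoped commutatorElement

/-! ### Free groups are residually solvable (Magnus-type representation) -/

/-- Operators on sequences that raise the index by at least `m`. -/
def J (m : ℕ) : AddSubgroup (Module.End ℤ (ℕ → ℤ)) where
  carrier := {T | ∀ f : ℕ → ℤ, ∀ i, (∀ j, i + m ≤ j → f j = 0) → T f i = 0}
  zero_mem' := by intro f i _; simp
  add_mem' := by
    intro a b ha hb f i h
    simp [ha f i h, hb f i h]
  neg_mem' := by
    intro a ha f i h
    simp [ha f i h]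

theorem J_mul {m n : ℕ} {T S : Module.End ℤ (ℕ → ℤ)} (hT : T ∈ J m) (hS : S ∈ J n) :
    T * S ∈ J (m + n) := by
  intro f i h
  rw [Module.End.mul_apply]
  apply hT
  intro j hj
  apply hS
  intro j' hj'
  apply h
  omega

theorem J_anti {m n : ℕ} (h : m ≤ n) {T : Module.End ℤ (ℕ → ℤ)} (hT : T ∈ J n) : T ∈ J m := by
  intro f i hf
  exact hT f i (fun j hj => hf j (by omega))

theorem one_mem_J : (1 : Module.End ℤ (ℕ → ℤ)) ∈ J 0 := by
  intro f i hf
  exact hf i (by omega)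

theorem mem_J_zero {m : ℕ} {T : Module.End ℤ (ℕ → ℤ)} (h : T - 1 ∈ J m) : T ∈ J 0 := by
  have := (J 0).add_mem (J_anti (Nat.zero_le m) h) one_mem_J
  simpa using this

/-- The congruence subgroups. -/
def K (m : ℕ) : Subgroup (Module.End ℤ (ℕ → ℤ))ˣ where
  carrier := {u | (u : Module.End ℤ (ℕ → ℤ)) - 1 ∈ J m ∧
    ((u⁻¹ : (Module.End ℤ (ℕ → ℤ))ˣ) : Module.End ℤ (ℕ → ℤ)) - 1 ∈ J m}
  one_mem' := by simp [(J m).zero_mem]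
  mul_mem' := by
    rintro a b ⟨ha, ha'⟩ ⟨hb, hb'⟩
    refine ⟨?_, ?_⟩
    · have h := (J m).add_mem (J_mul ha (mem_J_zero hb)) hb
      convert h using 1
      push_cast
      noncomm_ring
    · have h := (J m).add_mem (J_mul hb' (mem_J_zero ha')) ha'
      convert h using 1
      rw [mul_inv_rev]
      push_cast
      noncomm_ring
  inv_mem' := by
    rintro a ⟨ha, ha'⟩
    exact ⟨ha', by simpa using ha⟩

theorem comm_aux {m : ℕ} {u v : (Module.End ℤ (ℕ → ℤ))ˣ} (hu : u ∈ K m) (hv : v ∈ K m) :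
    ((⁅u, v⁆ : (Module.End ℤ (ℕ → ℤ))ˣ) : Module.End ℤ (ℕ → ℤ)) - 1 ∈ J (m + m) := by
  have h := (J (m + m)).sub_mem (J_mul hu.1 hv.1) (J_mul hv.1 hu.1)
  have h2 := J_mul (J_mul h (mem_J_zero hu.2)) (mem_J_zero hv.2)
  change _ ∈ J (m + m) at h2
  convert h2 using 1
  have e : ((u : Module.End ℤ (ℕ → ℤ)) - 1) * ((v : Module.End ℤ (ℕ → ℤ)) - 1)
      - ((v : Module.End ℤ (ℕ → ℤ)) - 1) * ((u : Module.End ℤ (ℕ → ℤ)) - 1) = u * v - v * u := by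
    noncomm_ring
  rw [e, commutatorElement_def, sub_mul, sub_mul]
  push_cast
  congr 1
  rw [mul_assoc (v : Module.End ℤ (ℕ → ℤ))]
  simp

theorem comm_K (m : ℕ) : ⁅K m, K m⁆ ≤ K (m + m) := by
  rw [Subgroup.commutator_le]
  intro u hu v hv
  refine ⟨comm_aux hu hv, ?_⟩
  rw [commutatorElement_inv]
  exact comm_aux hv hu

theorem K_anti {m n : ℕ} (h : m ≤ n) : K n ≤ K m := fun _ hu => ⟨J_anti h hu.1, J_anti h hu.2⟩

theorem derived_le_K {G : Type*} [Group G] (φ : G →* (Module.End ℤ (ℕ → ℤ))ˣ)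
    (h : ∀ g, φ g ∈ K 1) (n : ℕ) : (derivedSeries G n).map φ ≤ K (n + 1) := by
  induction n with
  | zero =>
    rintro _ ⟨g, _, rfl⟩
    exact h g
  | succ n ih =>
    rw [derivedSeries_succ, Subgroup.map_commutator]
    exact (Subgroup.commutator_mono ih ih).trans ((comm_K _).trans (K_anti (by omega)))

/-- The elementary operator of a letter relative to a sequence of letters. -/
noncomputable def X {α : Type*} (c : ℕ → Option α) (a : α) : Module.End ℤ (ℕ → ℤ) := by
  classical
  exact
  { toFun := fun f i => if c i = some a then f (i + 1) else 0
    map_add' := by intro f g; ext i; simp only [Pi.add_apply]; split_ifs <;> simp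
    map_smul' := by intro f g; ext i; simp }

open Classical in
theorem X_apply {α : Type*} (c : ℕ → Option α) (a : α) (f : ℕ → ℤ) (i : ℕ) :
    X c a f i = if c i = some a then f (i + 1) else 0 := by
  simp [X]

theorem X_mem {α : Type*} (c : ℕ → Option α) (a : α) : X c a ∈ J 1 := by
  intro f i h
  rw [X_apply, h (i + 1) le_rfl]; simp

theorem X_sq {α : Type*} (c : ℕ → Option α) (hc : ∀ i a, c i = some a → c (i + 1) ≠ some a)
    (a : α) : X c a * X c a = 0 := by
  ext f i
  rw [Module.End.mul_apply, X_apply]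
  split_ifs with h
  · rw [X_apply, if_neg (hc i a h)]; rfl
  · rfl

/-- `1 + X` as a unit. -/
noncomputable def U {α : Type*} (c : ℕ → Option α) (hc : ∀ i a, c i = some a → c (i + 1) ≠ some a)
    (a : α) : (Module.End ℤ (ℕ → ℤ))ˣ where
  val := 1 + X c a
  inv := 1 - X c a
  val_inv := by
    have := X_sq c hc a
    calc _ = 1 - X c a * X c a := by noncomm_ring
      _ = _ := by rw [this]; simp
  inv_val := by
    have := X_sq c hc a
    calc _ = 1 - X c a * X c a := by noncomm_ring
      _ = _ := by rw [this]; simp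

theorem U_zpow {α : Type*} (c : ℕ → Option α) (hc : ∀ i a, c i = some a → c (i + 1) ≠ some a)
    (a : α) (n : ℤ) :
    ((U c hc a ^ n : (Module.End ℤ (ℕ → ℤ))ˣ) : Module.End ℤ (ℕ → ℤ)) = 1 + n • X c a := by
  have hX := X_sq c hc a
  induction n using Int.induction_on with
  | zero => simp
  | succ n ih =>
    rw [zpow_add_one, Units.val_mul, ih]
    change (1 + (n : ℤ) • X c a) * (1 + X c a) = _
    rw [mul_add, add_mul, add_mul, smul_mul_assoc, smul_mul_assoc, hX, add_smul]
    simp [add_assoc]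
  | pred n ih =>
    rw [zpow_sub_one, Units.val_mul, ih]
    change (1 + (-n : ℤ) • X c a) * (1 - X c a) = _
    rw [mul_sub, add_mul, add_mul, smul_mul_assoc, smul_mul_assoc, hX, sub_smul]
    simp
    abel

open Monoid in
/-- The representation on the free product. -/
noncomputable def rep {α : Type*} (c : ℕ → Option α)
    (hc : ∀ i a, c i = some a → c (i + 1) ≠ some a) :
    CoprodI (fun _ : α => FreeGroup Unit) →* (Module.End ℤ (ℕ → ℤ))ˣ :=
  CoprodI.lift (fun a => FreeGroup.lift (fun _ => U c hc a))

theorem rep_mem {α : Type*} (c : ℕ → Option α)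
    (hc : ∀ i a, c i = some a → c (i + 1) ≠ some a) (g) : rep c hc g ∈ K 1 := by
  induction g using Monoid.CoprodI.induction_on with
  | one => simp [(K 1).one_mem]
  | of a m =>
    simp only [rep, Monoid.CoprodI.lift_of]
    induction m using FreeGroup.induction_on with
    | C1 => simp [(K 1).one_mem]
    | of x =>
      rw [FreeGroup.lift_apply_of]
      refine ⟨?_, ?_⟩
      · change 1 + X c a - 1 ∈ J 1
        simpa using X_mem c a
      · change 1 - X c a - 1 ∈ J 1
        simpa using (X_mem c a)
    | inv_of x h => rw [map_inv]; exact (K 1).inv_mem h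
    | mul x y hx hy => rw [map_mul]; exact (K 1).mul_mem hx hy
  | mul x y hx hy => rw [map_mul]; exact (K 1).mul_mem hx hy

theorem unit_pow (m : FreeGroup Unit) : ∃ n : ℤ, m = FreeGroup.of () ^ n := by
  induction m using FreeGroup.induction_on with
  | C1 => exact ⟨0, by simp⟩
  | of x => exact ⟨1, by simp⟩
  | inv_of x h => exact ⟨-1, by simp⟩
  | mul x y hx hy =>
    obtain ⟨a, rfl⟩ := hx
    obtain ⟨b, rfl⟩ := hy
    exact ⟨a + b, by rw [zpow_add]⟩

open Monoid in
theorem rep_word {α : Type*} (c : ℕ → Option α)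
    (hc : ∀ i a, c i = some a → c (i + 1) ≠ some a) (N : ℕ)
    (L : List (Σ _ : α, FreeGroup Unit)) (hL : ∀ l ∈ L, l.2 ≠ 1) (s : ℕ) (hs : s + L.length = N)
    (hcs : ∀ i, L[i]?.map Sigma.fst = c (s + i)) :
    (∀ i < s, (rep c hc (L.map fun l => CoprodI.of (M := fun _ : α => FreeGroup Unit) (i := l.1) l.2).prod).val (Pi.single N 1) i = 0) ∧
      (rep c hc (L.map fun l => CoprodI.of (M := fun _ : α => FreeGroup Unit) (i := l.1) l.2).prod).val (Pi.single N 1) s ≠ 0 := by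
  induction L generalizing s with
  | nil =>
    simp at hs
    subst hs
    simp
    intro i hi
    simp [Pi.single_apply, hi.ne]
  | cons x L ih =>
    obtain ⟨a, m⟩ := x
    obtain ⟨h1, h2⟩ := ih (fun l hl => hL l (by simp [hl])) (s + 1)
      (by simp at hs; omega) (by
        intro i
        have := hcs (i + 1)
        simp at this
        rw [this]
        congr 1
        omega)
    obtain ⟨n, rfl⟩ := unit_pow m
    have hn : n ≠ 0 := by
      rintro rfl
      exact hL _ (List.mem_cons_self) (by simp)
    have hcsa : c s = some a := by simpa using (hcs 0).symm
    have key : ∀ F : ℕ → ℤ, ∀ i, (rep c hc (CoprodI.of (M := fun _ : α => FreeGroup Unit) (i := a)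
        ((FreeGroup.of () : FreeGroup Unit) ^ n))).val F i = F i + n * X c a F i := by
      intro F i
      rw [rep, CoprodI.lift_of, map_zpow, FreeGroup.lift_apply_of, U_zpow]
      simp
    simp only [List.map_cons, List.prod_cons, map_mul, Units.val_mul, Module.End.mul_apply]
    refine ⟨?_, ?_⟩
    · intro i hi
      rw [key, h1 i (by omega), X_apply, h1 (i + 1) (by omega)]
      simp
    · rw [key, h1 s (by omega), X_apply, if_pos hcsa]
      simp [hn]
      exact h2

open Monoid in
theorem coprod_res {α : Type*} (g : CoprodI (fun _ : α => FreeGroup Unit))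
    (h : ∀ n, g ∈ derivedSeries _ n) : g = 1 := by
  classical
  obtain ⟨w, rfl⟩ := CoprodI.Word.equiv.symm.surjective g
  change CoprodI.Word.prod w = 1
  replace h : ∀ n, CoprodI.Word.prod w ∈ derivedSeries _ n := h
  by_cases hw : w.toList = []
  · simp [CoprodI.Word.prod, hw]
  exfalso
  let c : ℕ → Option α := fun i => w.toList[i]?.map Sigma.fst
  have hc : ∀ i a, c i = some a → c (i + 1) ≠ some a := by
    intro i a h1 h2
    simp only [c, Option.map_eq_some_iff, List.getElem?_eq_some_iff] at h1 h2
    obtain ⟨x, ⟨hx, rfl⟩, h1⟩ := h1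
    obtain ⟨y, ⟨hy, rfl⟩, h2⟩ := h2
    have := List.isChain_iff_getElem.1 w.chain_ne i hy
    exact this (h1.trans h2.symm)
  have h0 := (rep_word c hc w.toList.length w.toList w.ne_one 0 (by simp) (by simp [c])).2
  have hk := derived_le_K (rep c hc) (rep_mem c hc) w.toList.length
    (Subgroup.mem_map_of_mem _ (h _))
  have := hk.1 (Pi.single w.toList.length 1) 0 (by
    intro j hj
    have : j ≠ w.toList.length := by omega
    simp [Pi.single_apply, this])
  rw [LinearMap.sub_apply, Pi.sub_apply] at this
  have hne : 0 ≠ w.toList.length := by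
    intro h; exact hw (List.length_eq_zero_iff.1 h.symm)
  apply h0
  rw [Module.End.one_apply, Pi.single_eq_of_ne hne, sub_zero] at this
  exact this

theorem free_res {α : Type*} (g : FreeGroup α) (h : ∀ n, g ∈ derivedSeries _ n) : g = 1 := by
  have := coprod_res (freeGroupEquivCoprodI g) (fun n =>
    map_derivedSeries_le_derivedSeries (freeGroupEquivCoprodI (ι := α)).toMonoidHom n
      (Subgroup.mem_map_of_mem _ (h n)))
  exact (MulEquiv.map_eq_one_iff _).1 this

/-! ### Words in Baumslag–Solitar groups -/

/-- Value of a word `x^a₁ t^±1 x^a₂ t^±1 ⋯`. -/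
def val {G : Type*} [Group G] (x t : G) : List (ℤ × Bool) → G
  | [] => 1
  | (a, true) :: w => x ^ a * t * val x t w
  | (a, false) :: w => x ^ a * t⁻¹ * val x t w

theorem val_shift {G : Type*} [Group G] (x t : G) (c : ℤ) (w : List (ℤ × Bool)) (b : ℤ) :
    ∃ (w' : List (ℤ × Bool)) (b' : ℤ), w'.length = w.length ∧ x ^ c * (val x t w * x ^ b) = val x t w' * x ^ b' := by
  rcases w with _ | ⟨⟨a, _ | _⟩, w⟩
  · exact ⟨[], c + b, rfl, by simp [val, zpow_add]⟩
  · exact ⟨(c + a, false) :: w, b, rfl, by simp [val, zpow_add, mul_assoc]⟩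
  · exact ⟨(c + a, true) :: w, b, rfl, by simp [val, zpow_add, mul_assoc]⟩

/-- The sequence of edges crossed by a word. -/
def edges {H : Type*} [Group H] (y s : H) (C : Subgroup H) : H → List (ℤ × Bool) →
    List ((H ⧸ C) × Bool)
  | _, [] => []
  | p, (a, true) :: w => (((p * y ^ a : H) : H ⧸ C), true) :: edges y s C (p * y ^ a * s) w
  | p, (a, false) :: w => (((p * y ^ a * s⁻¹ : H) : H ⧸ C), false) ::
      edges y s C (p * y ^ a * s⁻¹) w

theorem edges_ne_nil {H : Type*} [Group H] (y s : H) (C : Subgroup H) (p : H) (w)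
    (h : edges y s C p w = []) : w = [] := by
  rcases w with _ | ⟨⟨a, _ | _⟩, w⟩
  · rfl
  · simp [edges] at h
  · simp [edges] at h

theorem conj_zpow {G : Type*} [Group G] {x t : G} {l k : ℤ} (hG : x ^ l * t = t * x ^ k) (j : ℤ) :
    x ^ (l * j) * t = t * x ^ (k * j) := by
  have h : x ^ l = t * x ^ k * t⁻¹ := by rw [← hG]; group
  rw [zpow_mul, h, _root_.conj_zpow, zpow_mul]
  group

theorem cancel {G H : Type*} [Group G] [Group H] {x t : G} {y s : H} {l k : ℤ}
    (hG : x ^ l * t = t * x ^ k) (hH : y ^ l * s = s * y ^ k) (hy : ∀ n : ℤ, y ^ n = 1 → n = 0)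
    (w : List (ℤ × Bool)) : ∀ (p : H),
    ¬ FreeGroup.IsReduced (edges y s (Subgroup.zpowers (y ^ l)) p w) →
    ∃ (w' : List (ℤ × Bool)) (b' : ℤ), w'.length < w.length ∧ val x t w = val x t w' * x ^ b' := by
  have hinj : ∀ m n : ℤ, y ^ m = y ^ n → m = n := by
    intro m n h
    have := hy (m - n) (by rw [zpow_sub, h, mul_inv_cancel])
    omega
  induction w with
  | nil => intro p h; exact absurd FreeGroup.IsReduced.nil h
  | cons u w ih =>
    intro p h
    rcases w with _ | ⟨⟨a', e'⟩, w⟩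
    · obtain ⟨a, _ | _⟩ := u <;> exact absurd FreeGroup.IsReduced.singleton h
    -- tail case
    have tail : ∀ p', ¬ FreeGroup.IsReduced (edges y s (Subgroup.zpowers (y ^ l)) p'
        ((a', e') :: w)) → ∃ (w' : List (ℤ × Bool)) (b' : ℤ), w'.length < (u :: (a', e') :: w).length ∧
        val x t (u :: (a', e') :: w) = val x t w' * x ^ b' := by
      intro p' hp'
      obtain ⟨w', b', hlen, hv⟩ := ih p' hp'
      refine ⟨u :: w', b', by simpa using hlen, ?_⟩
      obtain ⟨a, _ | _⟩ := u <;> simp only [val.eq_2, val.eq_3, hv, mul_assoc]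
    have head : ∀ c : ℤ, val x t (u :: (a', e') :: w) = x ^ c * val x t w →
        ∃ (w' : List (ℤ × Bool)) (b' : ℤ), w'.length < (u :: (a', e') :: w).length ∧
        val x t (u :: (a', e') :: w) = val x t w' * x ^ b' := by
      intro c hc
      obtain ⟨w', b', hlen, hv⟩ := val_shift x t c w 0
      refine ⟨w', b', by simp; omega, ?_⟩
      rw [hc, ← hv]; simp
    obtain ⟨a, e⟩ := u
    cases e <;> cases e'
    · rw [edges, edges, FreeGroup.isReduced_cons_cons] at h
      simp only [implies_true, true_and] at h
      exact tail (p * y ^ a * s⁻¹) (by rw [edges]; exact h)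
    · rw [edges, edges, FreeGroup.isReduced_cons_cons] at h
      by_cases hr : FreeGroup.IsReduced (edges y s (Subgroup.zpowers (y ^ l)) (p * y ^ a * s⁻¹)
        ((a', true) :: w))
      · rw [edges] at hr
        simp only [hr, and_true, Bool.false_eq_true, imp_false, not_not] at h
        rw [QuotientGroup.eq, Subgroup.mem_zpowers_iff] at h
        obtain ⟨j, hj⟩ := h
        have : a' = l * j := by
          apply hinj
          rw [zpow_mul, hj]; group
        subst this
        apply head (a + k * j)
        simp only [val]
        have := Stmt9.conj_zpow hG j
        calc x ^ a * t⁻¹ * (x ^ (l * j) * t * val x t w)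
            = x ^ a * t⁻¹ * (x ^ (l * j) * t) * val x t w := by group
          _ = _ := by rw [this]; group
      · exact tail _ hr
    · rw [edges, edges, FreeGroup.isReduced_cons_cons] at h
      by_cases hr : FreeGroup.IsReduced (edges y s (Subgroup.zpowers (y ^ l)) (p * y ^ a * s)
        ((a', false) :: w))
      · rw [edges] at hr
        simp only [hr, and_true, Bool.true_eq_false, imp_false, not_not] at h
        rw [QuotientGroup.eq, Subgroup.mem_zpowers_iff] at h
        obtain ⟨j, hj⟩ := h
        have : a' = k * j := by
          apply hinj
          have h1 := Stmt9.conj_zpow hH j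
          have h2 : y ^ (l * j) = s * y ^ a' * s⁻¹ := by
            rw [zpow_mul, hj]; group
          rw [h2] at h1
          have h3 : s * y ^ a' = s * y ^ (k * j) := by rw [← h1]; group
          exact mul_left_cancel h3
        subst this
        apply head (a + l * j)
        simp only [val]
        have := Stmt9.conj_zpow hG j
        calc x ^ a * t * (x ^ (k * j) * t⁻¹ * val x t w)
            = x ^ a * (t * x ^ (k * j)) * t⁻¹ * val x t w := by group
          _ = _ := by rw [← this]; group
      · exact tail _ hr
    · rw [edges, edges, FreeGroup.isReduced_cons_cons] at h
      simp only [implies_true, true_and] at h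
      exact tail (p * y ^ a * s) (by rw [edges]; exact h)

theorem exists_val (l k : ℤ) (g : BS l k) : ∃ w b,
    g = val (PresentedGroup.of 0) (PresentedGroup.of 1) w * (PresentedGroup.of 0) ^ (b : ℤ) := by
  have hg : g ∈ Subgroup.closure (Set.range (PresentedGroup.of (rels := {rel l k}))) := by
    rw [PresentedGroup.closure_range_of]; trivial
  induction hg using Subgroup.closure_induction_left with
  | one => exact ⟨[], 0, by simp [val]⟩
  | mul_left x hx y hy ih =>
    obtain ⟨i, rfl⟩ := hx
    obtain ⟨w, b, rfl⟩ := ih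
    fin_cases i
    · obtain ⟨w', b', -, h⟩ := val_shift (PresentedGroup.of 0 : BS l k) (PresentedGroup.of 1) 1 w b
      exact ⟨w', b', by rw [← h]; simp⟩
    · exact ⟨(0, true) :: w, b, by simp [val, mul_assoc]⟩
  | inv_mul_cancel x hx y hy ih =>
    obtain ⟨i, rfl⟩ := hx
    obtain ⟨w, b, rfl⟩ := ih
    fin_cases i
    · obtain ⟨w', b', -, h⟩ := val_shift (PresentedGroup.of 0 : BS l k) (PresentedGroup.of 1) (-1) w b
      exact ⟨w', b', by rw [← h]; simp⟩
    · exact ⟨(0, false) :: w, b, by simp [val, mul_assoc]⟩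

theorem bs_rel (l k : ℤ) : (PresentedGroup.of 0 : BS l k) ^ l * PresentedGroup.of 1 =
    PresentedGroup.of 1 * (PresentedGroup.of 0 : BS l k) ^ k := by
  have h : PresentedGroup.mk {rel l k} (rel l k) = 1 :=
    PresentedGroup.one_of_mem (Set.mem_singleton _)
  simp only [rel, map_mul, map_inv, map_zpow] at h
  change (PresentedGroup.of 1 : BS l k)⁻¹ * (PresentedGroup.of 0) ^ l * PresentedGroup.of 1 *
    (PresentedGroup.of 0) ^ (-k) = 1 at h
  rw [zpow_neg, mul_inv_eq_one, mul_assoc, inv_mul_eq_iff_eq_mul] at h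
  exact h

/-! ### The embedding into a free-by-solvable group -/

/-- Action of `H` on the free group on the edges. -/
def act {H : Type*} [Group H] (C : Subgroup H) : H →* MulAut (FreeGroup (H ⧸ C)) where
  toFun h := FreeGroup.freeGroupCongr (MulAction.toPerm h)
  map_one' := by
    ext z
    induction z using FreeGroup.induction_on <;> simp_all
  map_mul' := by
    intro a b
    ext z
    induction z using FreeGroup.induction_on <;> simp_all [mul_smul]

theorem act_of {H : Type*} [Group H] (C : Subgroup H) (h : H) (e : H ⧸ C) :
    act C h (FreeGroup.of e) = FreeGroup.of (h • e) := by
  simp [act]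

theorem inr_zpow_left {F H : Type*} [Group F] [Group H] (ψ : H →* MulAut F) (y : H) (a : ℤ) :
    ((SemidirectProduct.inr y : F ⋊[ψ] H) ^ a).left = 1 := by
  rw [← map_zpow, SemidirectProduct.left_inr]

theorem inr_zpow_right {F H : Type*} [Group F] [Group H] (ψ : H →* MulAut F) (y : H) (a : ℤ) :
    ((SemidirectProduct.inr y : F ⋊[ψ] H) ^ a).right = y ^ a := by
  rw [← map_zpow, SemidirectProduct.right_inr]

theorem val_left {H : Type*} [Group H] (y s : H) (C : Subgroup H) (w : List (ℤ × Bool)) : ∀ p : H,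
    act C p (val (G := FreeGroup (H ⧸ C) ⋊[act C] H) (SemidirectProduct.inr y)
      ⟨FreeGroup.of ((1 : H) : H ⧸ C), s⟩ w).left = FreeGroup.mk (edges y s C p w) := by
  induction w with
  | nil =>
    intro p
    simp only [val, edges, SemidirectProduct.one_left, map_one]
    rfl
  | cons u w ih =>
    intro p
    obtain ⟨a, _ | _⟩ := u
    · rw [val, edges, ← List.singleton_append, ← FreeGroup.mul_mk, ← ih,
        SemidirectProduct.mul_left, map_mul]
      congr 1
      · rw [SemidirectProduct.mul_left, inr_zpow_left, inr_zpow_right, one_mul,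
          SemidirectProduct.inv_left, map_inv, map_inv, map_inv, act_of, act_of, act_of,
          ← mul_smul, ← mul_smul]
        change (FreeGroup.of ((p * (y ^ a) * s⁻¹ * 1 : H) : H ⧸ C))⁻¹ = _
        rw [mul_one]
        rfl
      · rw [SemidirectProduct.mul_right, inr_zpow_right, SemidirectProduct.inv_right,
          map_mul, map_mul, map_mul]
        rfl
    · rw [val, edges, ← List.singleton_append, ← FreeGroup.mul_mk, ← ih,
        SemidirectProduct.mul_left, map_mul]
      congr 1
      · rw [SemidirectProduct.mul_left, inr_zpow_left, inr_zpow_right, one_mul,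
          act_of, act_of, ← mul_smul]
        change (FreeGroup.of ((p * (y ^ a) * 1 : H) : H ⧸ C)) = _
        rw [mul_one]
        rfl
      · rw [SemidirectProduct.mul_right, inr_zpow_right, map_mul, map_mul, map_mul]
        rfl

theorem derived_le_inl {F H : Type*} [Group F] [Group H] (ψ : H →* MulAut F) (m : ℕ)
    (hm : derivedSeries H m = ⊥) (n : ℕ) :
    derivedSeries (F ⋊[ψ] H) (m + n) ≤
      (derivedSeries F n).map (SemidirectProduct.inl : F →* F ⋊[ψ] H) := by
  induction n with
  | zero =>
    intro g hg
    have h := map_derivedSeries_le_derivedSeries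
      (SemidirectProduct.rightHom : F ⋊[ψ] H →* H) m (Subgroup.mem_map_of_mem _ hg)
    rw [hm, Subgroup.mem_bot] at h
    refine ⟨g.left, trivial, ?_⟩
    ext
    · simp
    · simpa using h.symm
  | succ n ih =>
    rw [← add_assoc, derivedSeries_succ, derivedSeries_succ, Subgroup.map_commutator]
    exact Subgroup.commutator_mono ih ih

theorem main_aux (l k : ℤ) {H : Type*} [Group H] {y s : H} (hH : y ^ l * s = s * y ^ k)
    (hy : ∀ n : ℤ, y ^ n = 1 → n = 0) (m : ℕ) (hm : derivedSeries H m = ⊥)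
    (g : BS l k) (hg : ∀ n : ℕ, g ∈ derivedSeries (BS l k) n) : g = 1 := by
  let C := Subgroup.zpowers (y ^ l)
  let x' : FreeGroup (H ⧸ C) ⋊[act C] H := SemidirectProduct.inr y
  let t' : FreeGroup (H ⧸ C) ⋊[act C] H := ⟨FreeGroup.of ((1 : H) : H ⧸ C), s⟩
  have hrel : x' ^ l * t' = t' * x' ^ k := by
    simp only [x', t', ← map_zpow]
    ext
    · simp only [SemidirectProduct.mul_left, SemidirectProduct.left_inr,
        SemidirectProduct.right_inr, act_of, one_mul, map_one, mul_one]
      congr 1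
      change ((y ^ l * 1 : H) : H ⧸ C) = _
      rw [QuotientGroup.eq]
      simp [C]
    · simpa only [SemidirectProduct.mul_right, SemidirectProduct.right_inr] using hH
  let f : Fin 2 → FreeGroup (H ⧸ C) ⋊[act C] H := ![x', t']
  have hf : ∀ r ∈ ({rel l k} : Set (FreeGroup (Fin 2))), FreeGroup.lift f r = 1 := by
    rintro r rfl
    simp only [rel, map_mul, map_inv, map_zpow, FreeGroup.lift_apply_of]
    change t'⁻¹ * x' ^ l * t' * x' ^ (-k) = 1
    rw [mul_assoc t'⁻¹, hrel]
    group
  let Φ : BS l k →* FreeGroup (H ⧸ C) ⋊[act C] H := PresentedGroup.toGroup hf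
  have h0 : Φ (PresentedGroup.of 0) = x' := PresentedGroup.toGroup.of hf
  have h1 : Φ (PresentedGroup.of 1) = t' := PresentedGroup.toGroup.of hf
  have hval : ∀ w, Φ (val (PresentedGroup.of 0) (PresentedGroup.of 1) w) = val x' t' w := by
    intro w
    induction w with
    | nil => simp [val]
    | cons u w ih =>
      obtain ⟨a, _ | _⟩ := u <;> simp [val, ih, h0, h1]
  -- the image of `g` is trivial
  have hΦ : Φ g = 1 := by
    have hmem : ∀ n, Φ g ∈ (derivedSeries (FreeGroup (H ⧸ C)) n).map
        (SemidirectProduct.inl : _ →* FreeGroup (H ⧸ C) ⋊[act C] H) := fun n =>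
      derived_le_inl (act C) m hm n
        (map_derivedSeries_le_derivedSeries Φ (m + n) (Subgroup.mem_map_of_mem _ (hg _)))
    obtain ⟨z, -, hz⟩ := hmem 0
    have : z = 1 := by
      apply free_res
      intro n
      obtain ⟨z', hz', h⟩ := hmem n
      rw [← hz] at h
      rwa [← SemidirectProduct.inl_injective h]
    rw [← hz, this, map_one]
  -- injectivity
  obtain ⟨w, b, rfl⟩ := exists_val l k g
  clear hg
  induction hn : w.length using Nat.strong_induction_on generalizing w b with
  | _ n ih =>
    by_cases hw : w = []
    · subst hw
      have h2 : x' ^ b = 1 := by simpa [val, h0] using hΦ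
      have h3 := congrArg SemidirectProduct.right h2
      simp only [x', ← map_zpow, SemidirectProduct.right_inr, SemidirectProduct.one_right] at h3
      simp [val, hy b h3]
    · have hnr : ¬ FreeGroup.IsReduced (edges y s C 1 w) := by
        intro hr
        classical
        have h2 := congrArg SemidirectProduct.left hΦ
        have h3 := val_left y s C w 1
        rw [map_mul, hval, map_zpow, h0] at h2
        simp only [x', ← map_zpow, SemidirectProduct.mul_left, SemidirectProduct.left_inr,
          map_one, mul_one, SemidirectProduct.one_left] at h2
        rw [map_one, MulAut.one_apply] at h3
        have h4 : FreeGroup.mk (edges y s C 1 w) = 1 := by rw [← h3]; exact h2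
        have h5 := congrArg FreeGroup.toWord h4
        rw [FreeGroup.toWord_mk, hr.reduce_eq, FreeGroup.toWord_one] at h5
        exact hw (edges_ne_nil _ _ _ _ _ h5)
      obtain ⟨w', b', hlen, hv⟩ := cancel (bs_rel l k) hH hy w 1 hnr
      have e : val (PresentedGroup.of 0 : BS l k) (PresentedGroup.of 1) w *
          (PresentedGroup.of 0) ^ b = val (PresentedGroup.of 0 : BS l k) (PresentedGroup.of 1) w' *
          (PresentedGroup.of 0) ^ (b' + b) := by
        rw [hv, zpow_add, mul_assoc]
      rw [e] at hΦ ⊢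
      exact ih _ (hn ▸ hlen) w' (b' + b) hΦ rfl

/-! ### The affine group of `ℚ` -/

/-- Scaling action of `ℚˣ` on the multiplicative copy of `ℚ`. -/
def scale : ℚˣ →* MulAut (Multiplicative ℚ) where
  toFun u := AddEquiv.toMultiplicative (DistribMulAction.toAddEquiv ℚ u)
  map_one' := by ext z; simp
  map_mul' := by intro a b; ext z; simp [mul_smul]

theorem stmt9 (l k : ℤ) (hl : l ≠ 0) (hk : k ≠ 0) :
    ∀ g : BS l k, (∀ n : ℕ, g ∈ derivedSeries (BS l k) n) → g = 1 := by
  intro g hg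
  have hl' : (l : ℚ) ≠ 0 := by exact_mod_cast hl
  have hk' : (k : ℚ) ≠ 0 := by exact_mod_cast hk
  let y : Multiplicative ℚ ⋊[scale] ℚˣ := SemidirectProduct.inl (Multiplicative.ofAdd 1)
  let s : Multiplicative ℚ ⋊[scale] ℚˣ :=
    SemidirectProduct.inr (Units.mk0 ((l : ℚ) / k) (div_ne_zero hl' hk'))
  have hpow : ∀ n : ℤ, y ^ n = SemidirectProduct.inl (Multiplicative.ofAdd (n : ℚ)) := by
    intro n
    simp only [y, ← map_zpow, ← ofAdd_zsmul]
    simp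
  refine main_aux l k (y := y) (s := s) ?_ ?_ 2 ?_ g hg
  · rw [hpow, hpow]
    ext
    · rw [SemidirectProduct.mul_left, SemidirectProduct.mul_left]
      simp only [s, SemidirectProduct.left_inl, SemidirectProduct.right_inl,
        SemidirectProduct.left_inr, SemidirectProduct.right_inr, map_one, mul_one, one_mul]
      change Multiplicative.ofAdd (l : ℚ) = Multiplicative.ofAdd ((l / k : ℚ) * k)
      congr 1
      field_simp
    · simp [s]
  · intro n h
    rw [hpow] at h
    have h := congrArg (fun z => Multiplicative.toAdd z.left) h
    simpa using h
  · rw [eq_bot_iff]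
    have h1 : derivedSeries ℚˣ 1 = ⊥ := by
      rw [derivedSeries_one, commutator_eq_bot_iff_center_eq_top]
      exact CommGroup.center_eq_top
    refine (derived_le_inl scale 1 h1 1).trans ?_
    have h2 : derivedSeries (Multiplicative ℚ) 1 = ⊥ := by
      rw [derivedSeries_one, commutator_eq_bot_iff_center_eq_top]
      exact CommGroup.center_eq_top
    rw [h2, Subgroup.map_bot]

end Stmt9
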